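/- arXiv:1006.0995 — 2 statements merged into one kernel-verified Lean document; each statement's English description precedes it below -/
import Mathlib

section
/- Let n be a nonzero vector in ℝ³ and let W be a 3×3 real matrix such that W·t = 0 for every vector t ∈ ℝ³ orthogonal to n (i.e., with t·n = 0). Then (S₁W)·n = 0. -/
open Matrix

/-- `S₁W = Wᵀ − tr(W)·I` for a 3×3 real matrix `W`. -/
noncomputable def S1 (W : Matrix (Fin 3) (Fin 3) ℝ) : Matrix (Fin 3) (Fin 3) ℝ :=
  Wᵀ - W.trace • (1 : Matrix (Fin 3) (Fin 3) ℝ)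

/-- A real matrix annihilating the orthogonal complement of a nonzero vector `n` has the form
`a nᵀ`. -/
theorem exists_eq_vecMulVec_of_mulVec_eq_zero {m ι : Type*} [Fintype ι]
    {n : ι → ℝ} (hn : n ≠ 0) {W : Matrix m ι ℝ}
    (hW : ∀ t : ι → ℝ, t ⬝ᵥ n = 0 → W *ᵥ t = 0) :
    ∃ a : m → ℝ, W = vecMulVec a n := by
  classical
  have hnn : n ⬝ᵥ n ≠ 0 := mt dotProduct_self_eq_zero.mp hn
  refine ⟨(n ⬝ᵥ n)⁻¹ • W *ᵥ n, ext_of_mulVec_single fun j => ?_⟩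
  set x : ι → ℝ := Pi.single j 1
  have h := hW (x - (x ⬝ᵥ n / (n ⬝ᵥ n)) • n) (by
    rw [sub_dotProduct, smul_dotProduct, smul_eq_mul, div_mul_cancel₀ _ hnn, sub_self])
  rw [mulVec_sub, mulVec_smul, sub_eq_zero] at h
  rw [h, vecMulVec_mulVec, dotProduct_comm n x, op_smul_eq_smul, smul_smul, div_eq_mul_inv]

/-- If `n ≠ 0` and the 3×3 matrix `W` annihilates every vector `t` orthogonal to `n`,
then `(S₁W)·n = 0`. -/
theorem S1_mulVec_normal_eq_zero
    (n : Fin 3 → ℝ) (hn : n ≠ 0)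
    (W : Matrix (Fin 3) (Fin 3) ℝ)
    (hW : ∀ t : Fin 3 → ℝ, t ⬝ᵥ n = 0 → W.mulVec t = 0) :
    (S1 W).mulVec n = 0 := by
  obtain ⟨a, rfl⟩ := exists_eq_vecMulVec_of_mulVec_eq_zero hn hW
  rw [S1, sub_mulVec, smul_mulVec, one_mulVec, transpose_vecMulVec, vecMulVec_mulVec,
    trace_vecMulVec, op_smul_eq_smul, sub_self]
end

section
/- For every 3×3 real matrix W and all vectors n = (n₁, n₂, n₃) and μ = (μ₁, μ₂, μ₃) in ℝ³, the following identity holds: ((S₁W)·n)·μ = (W·(n₂, −n₁, 0)ᵀ)·(−μ₂, μ₁, 0)ᵀ + (W·(n₃, 0, −n₁)ᵀ)·(−μ₃, 0, μ₁)ᵀ + (W·(0, n₃, −n₂)ᵀ)·(0, −μ₃, μ₂)ᵀ, where · between a matrix and a vector is matrix-vector multiplication and · between two vectors is the Euclidean inner product. -/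
open Matrix

/-- For every 3×3 real matrix `W` and all vectors `n, μ ∈ ℝ³`:
`((S₁W)·n)·μ = (W·(n₂,−n₁,0))·(−μ₂,μ₁,0) + (W·(n₃,0,−n₁))·(−μ₃,0,μ₁)
  + (W·(0,n₃,−n₂))·(0,−μ₃,μ₂)`. -/
theorem S1_normal_pairing (W : Matrix (Fin 3) (Fin 3) ℝ) (n μ : Fin 3 → ℝ) :
    (S1 W).mulVec n ⬝ᵥ μ =
      W.mulVec ![n 1, -n 0, 0] ⬝ᵥ ![-μ 1, μ 0, 0]
        + W.mulVec ![n 2, 0, -n 0] ⬝ᵥ ![-μ 2, 0, μ 0]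
        + W.mulVec ![0, n 2, -n 1] ⬝ᵥ ![0, -μ 2, μ 1] := by
  simp [S1, Matrix.trace, mulVec, dotProduct, Fin.sum_univ_three, Matrix.one_apply]
  ring
end
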